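/- arXiv:cs/9812019 — 2 statements merged into one kernel-verified Lean document; each statement's English description precedes it below -/
import Mathlib

section
/- Let (Q, Σ, ∘_l, ∘_r) be a two-way automaton. For all words u, v ∈ Σ^*, the global transition relations of the concatenation uv satisfy: [− uv →] = [− v →]([u ⇌][⇌ v])^*[− u →]; [uv ⇌] = [v ⇌] ∪ [− v →][u ⇌]([⇌ v][u ⇌])^*[← v −]; [⇌ uv] = [⇌ u] ∪ [← u −][⇌ v]([u ⇌][⇌ v])^*[− u →]; and [← uv −] = [← u −]([⇌ v][u ⇌])^*[← v −]. -/
/-- Relations on a set, written as `R q' q` meaning `(q', q) ∈ R` (output first). -/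
abbrev Rl (α : Type) := α → α → Prop

/-- Relational composition: `(c,a) ∈ S T` iff there is `b` with `(c,b) ∈ S` and `(b,a) ∈ T`. -/
def rcomp {α : Type} (S T : Rl α) : Rl α := fun c a => ∃ b, S c b ∧ T b a

/-- The identity (diagonal) relation. -/
def rid {α : Type} : Rl α := fun a b => a = b

/-- The empty (nowhere-defined) relation. -/
def rbot {α : Type} : Rl α := fun _ _ => False

/-- Union of relations. -/
def runion {α : Type} (S T : Rl α) : Rl α := fun a b => S a b ∨ T a b

/-- Powers of a relation, `rpow S 0 = rid`. -/
def rpow {α : Type} (S : Rl α) : ℕ → Rl α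
  | 0 => rid
  | n + 1 => rcomp S (rpow S n)

/-- Kleene star: union of all powers. -/
def rstar {α : Type} (S : Rl α) : Rl α := fun a b => ∃ n, rpow S n a b

/-- A (non-deterministic) two-way automaton: left- and right-moving next-state functions. -/
structure TWA (Q A : Type) where
  ol : A → Q → Set Q
  or : Q → A → Set Q

/-- One step of a two-way automaton on the word `w`: a configuration is a pair
`(i, q)` with `0 ≤ i ≤ w.length` (the pointer sits between cells `i` and `i+1`). -/
def TStep {Q A : Type} (M : TWA Q A) (w : List A) : (ℕ × Q) → (ℕ × Q) → Prop := fun c c' =>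
  (∃ x, w[c.1 - 1]? = some x ∧ 1 ≤ c.1 ∧ c'.1 = c.1 - 1 ∧ c'.2 ∈ M.ol x c.2) ∨
  (∃ x, w[c.1]? = some x ∧ c'.1 = c.1 + 1 ∧ c'.2 ∈ M.or c.2 x)

/-- A computation: a finite (possibly empty) sequence of steps. -/
def TReach {Q A : Type} (M : TWA Q A) (w : List A) : (ℕ × Q) → (ℕ × Q) → Prop :=
  Relation.ReflTransGen (TStep M w)

/-- The left-moving states. -/
def QlS {Q A : Type} (M : TWA Q A) : Set Q := {q | ∃ x, (M.ol x q).Nonempty}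

/-- The right-moving states. -/
def QrS {Q A : Type} (M : TWA Q A) : Set Q := {q | ∃ x, (M.or q x).Nonempty}

/-- `[← w −]` : computations from the right end to the left end. -/
def gRL {Q A : Type} (M : TWA Q A) (w : List A) : Rl Q := fun q' q =>
  q ∈ QlS M ∧ q' ∈ QlS M ∧ TReach M w (w.length, q) (0, q')

/-- `[− w →]` : computations from the left end to the right end. -/
def gLR {Q A : Type} (M : TWA Q A) (w : List A) : Rl Q := fun q' q =>
  q ∈ QrS M ∧ q' ∈ QrS M ∧ TReach M w (0, q) (w.length, q')

/-- `[⇌ w]` : computations from the left end back to the left end. -/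
def gLL {Q A : Type} (M : TWA Q A) (w : List A) : Rl Q := fun q' q =>
  q ∈ QrS M ∧ q' ∈ QlS M ∧ TReach M w (0, q) (0, q')

/-- `[w ⇌]` : computations from the right end back to the right end. -/
def gRR {Q A : Type} (M : TWA Q A) (w : List A) : Rl Q := fun q' q =>
  q ∈ QlS M ∧ q' ∈ QrS M ∧ TReach M w (w.length, q) (w.length, q')

theorem rstar_refl {α : Type} (S : Rl α) (a : α) : rstar S a a := ⟨0, rfl⟩

theorem rstar_tail {α : Type} {S : Rl α} {a b c : α} (h : S c b) : rstar S b a → rstar S c a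
  | ⟨n, hn⟩ => ⟨n + 1, b, h, hn⟩

/-- Induction along a Kleene star, from the input to the output. -/
theorem rstar_induction {α : Type} {S : Rl α} {a b : α} {P : α → Prop} (h : rstar S b a)
    (ha : P a) (hS : ∀ b c, S c b → P b → P c) : P b := by
  obtain ⟨n, hn⟩ := h
  induction n generalizing b with
  | zero => exact (show b = a from hn) ▸ ha
  | succ n ih =>
    obtain ⟨d, hd, hn⟩ := hn
    exact hS d b hd (ih hn)

section Concatenation

variable {Q A : Type} {M : TWA Q A} {u v : List A}

theorem TStep.append_right {c c' : ℕ × Q} (h : TStep M u c c') : TStep M (u ++ v) c c' := by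
  rcases h with ⟨x, hx, h⟩ | ⟨x, hx, h⟩
  · exact Or.inl ⟨x, by grind, h⟩
  · exact Or.inr ⟨x, by grind, h⟩

theorem TStep.append_left {c c' : ℕ × Q} (h : TStep M v c c') :
    TStep M (u ++ v) (u.length + c.1, c.2) (u.length + c'.1, c'.2) := by
  rcases h with ⟨x, hx, h1, h2, h⟩ | ⟨x, hx, h2, h⟩
  · exact Or.inl ⟨x, by grind, by grind, by grind, h⟩
  · exact Or.inr ⟨x, by grind, by grind, h⟩

theorem TReach.append_right {c c' : ℕ × Q} (h : TReach M u c c') : TReach M (u ++ v) c c' :=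
  Relation.ReflTransGen.mono (fun _ _ => TStep.append_right) _ _ h

theorem TReach.append_left {i j : ℕ} {p q : Q} (h : TReach M v (i, p) (j, q)) :
    TReach M (u ++ v) (u.length + i, p) (u.length + j, q) :=
  Relation.ReflTransGen.lift (fun c : ℕ × Q => (u.length + c.1, c.2))
    (fun _ _ => TStep.append_left) _ _ h

/-- If configurations on `u` and on `v` satisfy predicates `F` and `G` that are preserved by steps
and that agree where the pointer crosses the boundary, then every configuration on `u ++ v`
reachable from one satisfying `F` or `G` again satisfies `F` or `G`. -/
theorem TReach.append_invariant {F G : ℕ × Q → Prop}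
    (hF : ∀ c c', TStep M u c c' → F c → F c') (hG : ∀ c c', TStep M v c c' → G c → G c')
    (hFG : ∀ p ∈ QrS M, F (u.length, p) → G (0, p))
    (hGF : ∀ p ∈ QlS M, G (0, p) → F (u.length, p))
    {c c' : ℕ × Q} (h : TReach M (u ++ v) c c')
    (hc : c.1 ≤ u.length ∧ F c ∨ u.length ≤ c.1 ∧ G (c.1 - u.length, c.2)) :
    c'.1 ≤ u.length ∧ F c' ∨ u.length ≤ c'.1 ∧ G (c'.1 - u.length, c'.2) := by
  induction h with
  | refl => exact hc
  | @tail d e _ hs ih =>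
    clear hc
    obtain ⟨i, p⟩ := d
    obtain ⟨j, q⟩ := e
    dsimp only at ih ⊢
    rcases hs with ⟨x, hx, hi, hj, hq⟩ | ⟨x, hx, hj, hq⟩ <;> dsimp only at hx hj hq
    · dsimp only at hi
      by_cases hiu : i ≤ u.length
      · left
        have hFi : F (i, p) := by
          rcases ih with ih | ⟨hi', ih⟩
          · exact ih.2
          · obtain rfl : i = u.length := by omega
            exact hGF p ⟨x, q, hq⟩ (by simpa using ih)
        exact ⟨by omega, hF (i, p) (j, q) (Or.inl ⟨x, by grind, hi, hj, hq⟩) hFi⟩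
      · right
        have hGi := (ih.resolve_left fun h => hiu h.1).2
        exact ⟨by omega, hG _ _ (Or.inl ⟨x, by grind, by grind, by grind, hq⟩) hGi⟩
    · by_cases hiu : i < u.length
      · left
        have hFi := (ih.resolve_right fun h => by omega).2
        exact ⟨by omega, hF _ _ (Or.inr ⟨x, by grind, hj, hq⟩) hFi⟩
      · right
        have hGi : G (i - u.length, p) := by
          rcases ih with ⟨hi', ih⟩ | ih
          · obtain rfl : i = u.length := by omega
            simpa using hFG p ⟨x, q, hq⟩ ih
          · exact ih.2
        exact ⟨by omega, hG _ _ (Or.inr ⟨x, by grind, by grind, hq⟩) hGi⟩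

variable (M u v) in
/-- The relation taking `q`, read at the left end of `u ++ v`, to a state in which the pointer
crosses from `u` into `v`. -/
abbrev enterRight : Rl Q := rcomp (rstar (rcomp (gRR M u) (gLL M v))) (gLR M u)

variable (M u v) in
/-- The relation taking `q`, read at the right end of `u ++ v`, to a state in which the pointer
crosses from `v` into `u`. -/
abbrev enterLeft : Rl Q := rcomp (rstar (rcomp (gLL M v) (gRR M u))) (gRL M v)

theorem enterRight_spec {p q : Q} (h : enterRight M u v p q) :
    q ∈ QrS M ∧ p ∈ QrS M ∧ TReach M (u ++ v) (0, q) (u.length, p) := by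
  obtain ⟨b, hs, hq, hb, hr⟩ := h
  refine rstar_induction (P := fun p => q ∈ QrS M ∧ p ∈ QrS M ∧
    TReach M (u ++ v) (0, q) (u.length, p)) hs ⟨hq, hb, hr.append_right⟩ ?_
  rintro a c ⟨d, ⟨-, hc, hdc⟩, -, -, had⟩ ⟨-, -, hqa⟩
  exact ⟨hq, hc, (hqa.trans had.append_left).trans hdc.append_right⟩

theorem enterLeft_spec {p q : Q} (h : enterLeft M u v p q) :
    q ∈ QlS M ∧ p ∈ QlS M ∧ TReach M (u ++ v) ((u ++ v).length, q) (u.length, p) := by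
  obtain ⟨b, hs, hq, hb, hr⟩ := h
  rw [List.length_append]
  refine rstar_induction (P := fun p => q ∈ QlS M ∧ p ∈ QlS M ∧
    TReach M (u ++ v) (u.length + v.length, q) (u.length, p)) hs ⟨hq, hb, hr.append_left⟩ ?_
  rintro a c ⟨d, ⟨-, hc, hdc⟩, -, -, had⟩ ⟨-, -, hqa⟩
  exact ⟨hq, hc, (hqa.trans had.append_right).trans hdc.append_left⟩

theorem enterRight_tail {p a b q : Q} (h : enterRight M u v a q) (hb : gLL M v b a)
    (hp : gRR M u p b) : enterRight M u v p q :=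
  let ⟨d, hs, hd⟩ := h
  ⟨d, rstar_tail ⟨b, hp, hb⟩ hs, hd⟩

theorem enterLeft_tail {p a b q : Q} (h : enterLeft M u v a q) (hb : gRR M u b a)
    (hp : gLL M v p b) : enterLeft M u v p q :=
  let ⟨d, hs, hd⟩ := h
  ⟨d, rstar_tail ⟨b, hp, hb⟩ hs, hd⟩

/-- A configuration on `u`, as part of a computation on `u ++ v` from the left end in state `q`. -/
def LeftStartU (M : TWA Q A) (u v : List A) (q : Q) (c : ℕ × Q) : Prop :=
  TReach M u (0, q) c ∨
    ∃ a, rcomp (gLL M v) (enterRight M u v) a q ∧ TReach M u (u.length, a) c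

/-- A configuration on `v`, as part of a computation on `u ++ v` from the left end in state `q`. -/
def LeftStartV (M : TWA Q A) (u v : List A) (q : Q) (c : ℕ × Q) : Prop :=
  ∃ a, enterRight M u v a q ∧ TReach M v (0, a) c

/-- A configuration on `u`, as part of a computation on `u ++ v` from the right end in state `q`. -/
def RightStartU (M : TWA Q A) (u v : List A) (q : Q) (c : ℕ × Q) : Prop :=
  ∃ a, enterLeft M u v a q ∧ TReach M u (u.length, a) c

/-- A configuration on `v`, as part of a computation on `u ++ v` from the right end in state `q`. -/
def RightStartV (M : TWA Q A) (u v : List A) (q : Q) (c : ℕ × Q) : Prop :=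
  TReach M v (v.length, q) c ∨
    ∃ a, rcomp (gRR M u) (enterLeft M u v) a q ∧ TReach M v (0, a) c

theorem LeftStartU.toV {p q : Q} (hq : q ∈ QrS M) (hp : p ∈ QrS M)
    (h : LeftStartU M u v q (u.length, p)) : LeftStartV M u v q (0, p) := by
  rcases h with h | ⟨a, ⟨b, hb, hbq⟩, h⟩
  · exact ⟨p, ⟨p, rstar_refl _ _, hq, hp, h⟩, .refl⟩
  · exact ⟨p, enterRight_tail hbq hb ⟨hb.2.1, hp, h⟩, .refl⟩

theorem LeftStartV.toU {p q : Q} (hp : p ∈ QlS M)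
    (h : LeftStartV M u v q (0, p)) : LeftStartU M u v q (u.length, p) := by
  obtain ⟨a, ha, h⟩ := h
  exact Or.inr ⟨p, ⟨a, ⟨(enterRight_spec ha).2.1, hp, h⟩, ha⟩, .refl⟩

theorem RightStartV.toU {p q : Q} (hq : q ∈ QlS M) (hp : p ∈ QlS M)
    (h : RightStartV M u v q (0, p)) : RightStartU M u v q (u.length, p) := by
  rcases h with h | ⟨a, ⟨b, hb, hbq⟩, h⟩
  · exact ⟨p, ⟨p, rstar_refl _ _, hq, hp, h⟩, .refl⟩
  · exact ⟨p, enterLeft_tail hbq hb ⟨hb.2.1, hp, h⟩, .refl⟩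

theorem RightStartU.toV {p q : Q} (hp : p ∈ QrS M)
    (h : RightStartU M u v q (u.length, p)) : RightStartV M u v q (0, p) := by
  obtain ⟨a, ha, h⟩ := h
  exact Or.inr ⟨p, ⟨a, ⟨(enterLeft_spec ha).2.1, hp, h⟩, ha⟩, .refl⟩

theorem TReach.leftStart {q : Q} (hq : q ∈ QrS M) {c : ℕ × Q}
    (h : TReach M (u ++ v) (0, q) c) :
    c.1 ≤ u.length ∧ LeftStartU M u v q c ∨
      u.length ≤ c.1 ∧ LeftStartV M u v q (c.1 - u.length, c.2) := by
  refine h.append_invariant ?_ ?_ (fun p hp => LeftStartU.toV hq hp)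
    (fun p hp => LeftStartV.toU hp) (Or.inl ⟨Nat.zero_le _, Or.inl .refl⟩)
  · rintro c c' hs (h | ⟨a, ha, h⟩)
    · exact Or.inl (h.tail hs)
    · exact Or.inr ⟨a, ha, h.tail hs⟩
  · rintro c c' hs ⟨a, ha, h⟩
    exact ⟨a, ha, h.tail hs⟩

theorem TReach.rightStart {q : Q} (hq : q ∈ QlS M) {c : ℕ × Q}
    (h : TReach M (u ++ v) ((u ++ v).length, q) c) :
    c.1 ≤ u.length ∧ RightStartU M u v q c ∨
      u.length ≤ c.1 ∧ RightStartV M u v q (c.1 - u.length, c.2) := by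
  refine h.append_invariant ?_ ?_ (fun p hp => RightStartU.toV hp)
    (fun p hp => RightStartV.toU hq hp) (Or.inr ⟨by simp, Or.inl ?_⟩)
  · rintro c c' hs ⟨a, ha, h⟩
    exact ⟨a, ha, h.tail hs⟩
  · rintro c c' hs (h | ⟨a, ha, h⟩)
    · exact Or.inl (h.tail hs)
    · exact Or.inr ⟨a, ha, h.tail hs⟩
  · rw [List.length_append, Nat.add_sub_cancel_left]
    exact .refl

theorem TReach.leftStartU {p q : Q} (hq : q ∈ QrS M) (hp : p ∈ QlS M)
    (h : TReach M (u ++ v) (0, q) (0, p)) : LeftStartU M u v q (0, p) := by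
  rcases h.leftStart hq with ⟨-, h⟩ | ⟨hu, h⟩
  · exact h
  · have hu : u.length = 0 := Nat.le_zero.1 hu
    rw [hu] at h
    exact hu ▸ LeftStartV.toU hp h

theorem TReach.leftStartV {p q : Q} (hq : q ∈ QrS M) (hp : p ∈ QrS M)
    (h : TReach M (u ++ v) (0, q) ((u ++ v).length, p)) :
    LeftStartV M u v q (v.length, p) := by
  rw [List.length_append] at h
  rcases h.leftStart hq with ⟨hv, h⟩ | ⟨-, h⟩
  · have hv : v.length = 0 := by simpa using hv
    rw [hv] at h ⊢
    exact LeftStartU.toV hq hp h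
  · simpa only [Nat.add_sub_cancel_left] using h

theorem TReach.rightStartU {p q : Q} (hq : q ∈ QlS M) (hp : p ∈ QlS M)
    (h : TReach M (u ++ v) ((u ++ v).length, q) (0, p)) : RightStartU M u v q (0, p) := by
  rcases h.rightStart hq with ⟨-, h⟩ | ⟨hu, h⟩
  · exact h
  · have hu : u.length = 0 := Nat.le_zero.1 hu
    rw [hu] at h
    exact hu ▸ RightStartV.toU hq hp h

theorem TReach.rightStartV {p q : Q} (hq : q ∈ QlS M) (hp : p ∈ QrS M)
    (h : TReach M (u ++ v) ((u ++ v).length, q) ((u ++ v).length, p)) :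
    RightStartV M u v q (v.length, p) := by
  rcases h.rightStart hq with ⟨hv, h⟩ | ⟨-, h⟩
  · have hv : v.length = 0 := by simpa using hv
    rw [List.length_append, hv] at h
    rw [hv]
    exact RightStartU.toV hp h
  · simpa only [List.length_append, Nat.add_sub_cancel_left] using h

end Concatenation

/-- Birget's equations: for a two-way automaton and all words
`u, v`, the global transition relations of `uv` are given in terms of those of
`u` and `v`. -/
theorem statement0 {Q A : Type} [Fintype Q] [Fintype A] (M : TWA Q A) (u v : List A) :
    gLR M (u ++ v) =
      rcomp (gLR M v) (rcomp (rstar (rcomp (gRR M u) (gLL M v))) (gLR M u)) ∧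
    gRR M (u ++ v) =
      runion (gRR M v)
        (rcomp (gLR M v)
          (rcomp (gRR M u) (rcomp (rstar (rcomp (gLL M v) (gRR M u))) (gRL M v)))) ∧
    gLL M (u ++ v) =
      runion (gLL M u)
        (rcomp (gRL M u)
          (rcomp (gLL M v) (rcomp (rstar (rcomp (gRR M u) (gLL M v))) (gLR M u)))) ∧
    gRL M (u ++ v) =
      rcomp (gRL M u) (rcomp (rstar (rcomp (gLL M v) (gRR M u))) (gRL M v)) := by
  refine ⟨?_, ?_, ?_, ?_⟩ <;> funext p q <;> refine propext ⟨?_, ?_⟩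
  · rintro ⟨hq, hp, h⟩
    obtain ⟨a, ha, h⟩ := h.leftStartV hq hp
    exact ⟨a, ⟨(enterRight_spec ha).2.1, hp, h⟩, ha⟩
  · rintro ⟨a, ⟨-, hp, h⟩, ha⟩
    obtain ⟨hq, -, ha⟩ := enterRight_spec ha
    exact ⟨hq, hp, List.length_append ▸ ha.trans h.append_left⟩
  · rintro ⟨hq, hp, h⟩
    rcases h.rightStartV hq hp with h | ⟨a, ⟨b, hb, hbq⟩, h⟩
    · exact Or.inl ⟨hq, hp, h⟩
    · exact Or.inr ⟨a, ⟨hb.2.1, hp, h⟩, b, hb, hbq⟩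
  · rintro (⟨hq, hp, h⟩ | ⟨a, ⟨-, hp, h⟩, b, ⟨-, -, hb⟩, hbq⟩)
    · exact ⟨hq, hp, List.length_append ▸ h.append_left⟩
    · obtain ⟨hq, -, hbq⟩ := enterLeft_spec hbq
      refine ⟨hq, hp, (hbq.trans hb.append_right).trans ?_⟩
      exact List.length_append ▸ h.append_left
  · rintro ⟨hq, hp, h⟩
    rcases h.leftStartU hq hp with h | ⟨a, ⟨b, hb, hbq⟩, h⟩
    · exact Or.inl ⟨hq, hp, h⟩
    · exact Or.inr ⟨a, ⟨hb.2.1, hp, h⟩, b, hb, hbq⟩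
  · rintro (⟨hq, hp, h⟩ | ⟨a, ⟨-, hp, h⟩, b, ⟨-, -, hb⟩, hbq⟩)
    · exact ⟨hq, hp, h.append_right⟩
    · obtain ⟨hq, -, hbq⟩ := enterRight_spec hbq
      exact ⟨hq, hp, (hbq.trans hb.append_left).trans h.append_right⟩
  · rintro ⟨hq, hp, h⟩
    obtain ⟨a, ha, h⟩ := h.rightStartU hq hp
    exact ⟨a, ⟨(enterLeft_spec ha).2.1, hp, h⟩, ha⟩
  · rintro ⟨a, ⟨-, hp, h⟩, ha⟩
    obtain ⟨hq, -, ha⟩ := enterLeft_spec ha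
    exact ⟨hq, hp, ha.trans h.append_right⟩
end

section
/- Let j and k be arbitrary relations on a set Q and let Q_l, Q_r ⊆ Q. Set U = (k 0; 0 j), σ = (0 1; 1 0) and π = (1_{Q_l} 0; 0 1_{Q_r}), where 2×2 matrices of relations are multiplied using relational composition and union, 1 and 0 denote the identity and empty relations on Q, and 1_{Q_l}, 1_{Q_r} are the restrictions of the identity relation to Q_l and Q_r. Then π U (σU)^* π = (1_{Q_l} k(jk)^* 1_{Q_l}, 1_{Q_l} (kj)(kj)^* 1_{Q_r}; 1_{Q_r} (jk)(jk)^* 1_{Q_l}, 1_{Q_r} j(kj)^* 1_{Q_r}), where the star of a matrix is the union of all its powers (the zeroth power being the identity matrix). -/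
/-- 2×2 matrices of relations. -/
abbrev M2 (α : Type) := Fin 2 → Fin 2 → Rl α

/-- Matrix multiplication: relational composition for products, union for sums. -/
def mmul {α : Type} (X Y : M2 α) : M2 α := fun i j c a => ∃ (l : Fin 2) (b : α), X i l c b ∧ Y l j b a

/-- The identity matrix of relations. -/
def mid {α : Type} : M2 α := fun i j => if i = j then rid else rbot

/-- Powers of a matrix of relations. -/
def mpow {α : Type} (X : M2 α) : ℕ → M2 α
  | 0 => mid
  | n + 1 => mmul X (mpow X n)

/-- Star of a matrix of relations: union of all its powers. -/
def mstar {α : Type} (X : M2 α) : M2 α := fun i j a b => ∃ n, mpow X n i j a b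

/-- Restriction of the identity relation to a subset. -/
def restr {α : Type} (S : Set α) : Rl α := fun a b => a = b ∧ a ∈ S

theorem rcomp_assoc {α : Type} (R S T : Rl α) :
    rcomp (rcomp R S) T = rcomp R (rcomp S T) := by
  ext c a
  constructor
  · rintro ⟨b, ⟨d, hR, hS⟩, hT⟩
    exact ⟨d, hR, b, hS, hT⟩
  · rintro ⟨d, hR, b, hS, hT⟩
    exact ⟨b, ⟨d, hR, hS⟩, hT⟩

theorem rid_rcomp {α : Type} (R : Rl α) : rcomp rid R = R := by
  ext c a
  simp [rcomp, rid]

theorem rbot_rcomp {α : Type} (R : Rl α) : rcomp rbot R = rbot := by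
  ext c a
  simp [rcomp, rbot]

theorem rcomp_rbot {α : Type} (R : Rl α) : rcomp R rbot = rbot := by
  ext c a
  simp [rcomp, rbot]

theorem rbot_runion {α : Type} (R : Rl α) : runion rbot R = R := by
  ext c a
  simp [runion, rbot]

theorem runion_rbot {α : Type} (R : Rl α) : runion R rbot = R := by
  ext c a
  simp [runion, rbot]

theorem rcomp_rstar_apply {α : Type} (R S : Rl α) (c a : α) :
    rcomp R (rstar S) c a ↔ ∃ n, rcomp R (rpow S n) c a := by
  constructor
  · rintro ⟨b, hR, n, hS⟩
    exact ⟨n, b, hR, hS⟩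
  · rintro ⟨n, b, hR, hS⟩
    exact ⟨b, hR, n, hS⟩

theorem mmul_of {α : Type} (a b c d a' b' c' d' : Rl α) :
    mmul (![![a, b], ![c, d]] : M2 α) ![![a', b'], ![c', d']] =
      ![![runion (rcomp a a') (rcomp b c'), runion (rcomp a b') (rcomp b d')],
        ![runion (rcomp c a') (rcomp d c'), runion (rcomp c b') (rcomp d d')]] := by
  ext i i' x y
  fin_cases i <;> fin_cases i' <;> simp [mmul, runion, rcomp, Fin.exists_fin_two]

theorem mpow_antidiagonal_even {α : Type} (j k : Rl α) (n : ℕ) :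
    mpow (![![rbot, j], ![k, rbot]] : M2 α) (2 * n) =
      ![![rpow (rcomp j k) n, rbot], ![rbot, rpow (rcomp k j) n]] := by
  induction n with
  | zero =>
    ext i i' x y
    fin_cases i <;> fin_cases i' <;> simp [mpow, mid, rpow]
  | succ n ih =>
    rw [Nat.mul_succ, mpow, mpow, ih]
    simp only [mmul_of, rbot_rcomp, rcomp_rbot, rbot_runion, runion_rbot, rpow, rcomp_assoc]

theorem mpow_antidiagonal_odd {α : Type} (j k : Rl α) (n : ℕ) :
    mpow (![![rbot, j], ![k, rbot]] : M2 α) (2 * n + 1) =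
      ![![rbot, rcomp j (rpow (rcomp k j) n)], ![rcomp k (rpow (rcomp j k) n), rbot]] := by
  rw [mpow, mpow_antidiagonal_even]
  simp only [mmul_of, rbot_rcomp, rcomp_rbot, rbot_runion, runion_rbot]

theorem mstar_antidiagonal {α : Type} (j k : Rl α) :
    mstar (![![rbot, j], ![k, rbot]] : M2 α) =
      ![![rstar (rcomp j k), rcomp j (rstar (rcomp k j))],
        ![rcomp k (rstar (rcomp j k)), rstar (rcomp k j)]] := by
  have exists_parity (p : ℕ → Prop) : (∃ n, p n) ↔ (∃ n, p (2 * n)) ∨ ∃ n, p (2 * n + 1) := by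
    constructor
    · rintro ⟨n, hn⟩
      obtain ⟨m, rfl | rfl⟩ := n.even_or_odd'
      exacts [.inl ⟨m, hn⟩, .inr ⟨m, hn⟩]
    · rintro (⟨n, hn⟩ | ⟨n, hn⟩) <;> exact ⟨_, hn⟩
  ext i i' x y
  rw [mstar, exists_parity]
  simp only [mpow_antidiagonal_even, mpow_antidiagonal_odd]
  fin_cases i <;> fin_cases i' <;> simp [rcomp_rstar_apply, rstar, rbot]

/-- for arbitrary relations `j, k` on `Q` and subsets `Q_l, Q_r ⊆ Q`,
with `U = (k 0; 0 j)`, `σ = (0 1; 1 0)`, `π = (1_{Q_l} 0; 0 1_{Q_r})`, one has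
`π U (σU)* π = (1_{Q_l} k(jk)* 1_{Q_l}, 1_{Q_l} (kj)(kj)* 1_{Q_r};
1_{Q_r} (jk)(jk)* 1_{Q_l}, 1_{Q_r} j(kj)* 1_{Q_r})`. -/
theorem statement3 {Q : Type} (j k : Rl Q) (Ql Qr : Set Q) :
    mmul (![![restr Ql, rbot], ![rbot, restr Qr]] : M2 Q)
      (mmul (![![k, rbot], ![rbot, j]] : M2 Q)
        (mmul
          (mstar (mmul (![![rbot, rid], ![rid, rbot]] : M2 Q)
            (![![k, rbot], ![rbot, j]] : M2 Q)))
          (![![restr Ql, rbot], ![rbot, restr Qr]] : M2 Q))) =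
    (![![rcomp (restr Ql) (rcomp k (rcomp (rstar (rcomp j k)) (restr Ql))),
        rcomp (restr Ql) (rcomp (rcomp k j) (rcomp (rstar (rcomp k j)) (restr Qr)))],
      ![rcomp (restr Qr) (rcomp (rcomp j k) (rcomp (rstar (rcomp j k)) (restr Ql))),
        rcomp (restr Qr) (rcomp j (rcomp (rstar (rcomp k j)) (restr Qr)))]] : M2 Q) := by
  simp only [mmul_of, rid_rcomp, rbot_rcomp, rcomp_rbot, rbot_runion, runion_rbot,
    mstar_antidiagonal, rcomp_assoc]
end
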